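/- arXiv:1511.03922 — 2 statements merged into one kernel-verified Lean document; each statement's English description precedes it below -/
import Mathlib

section
/- In the one-dimensional concentration setting, let ε > 0 be small enough so that γ(ε) ≤ σ²/2 and let λ ≥ 2/σ². Let c : 𝕋 → [0,1] be the piecewise linear cut function which equals 1 on [−ε/2, ε/2], equals 0 outside [−ε, ε], and interpolates linearly in between. Then ‖(1−c)·e^{λφ}‖_A ≤ (1 + C_H(√(2/(πε)) + λ‖φ′‖_∞))·e^{−λMε²/4}, where C_H = π/√3. -/
open scoped Real
open MeasureTheory Filter Asymptotics Topology

noncomputable section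

/-- `n`-th Fourier coefficient of a `2π`-periodic function `f : ℝ → ℂ` (function on the torus). -/
def fCoeff (f : ℝ → ℂ) (n : ℤ) : ℂ :=
  (∫ θ in (-Real.pi)..Real.pi, f θ * Complex.exp (-(Complex.I * (n : ℂ) * (θ : ℂ)))) /
    ((2 * Real.pi : ℝ) : ℂ)

/-- Norm of the Wiener algebra `A(𝕋)`. -/
def wienerNorm (f : ℝ → ℂ) : ℝ := ∑' n : ℤ, ‖fCoeff f n‖

/-- Membership in the Wiener algebra: the Fourier series of `f` converges absolutely
and represents `f`. -/
def MemWiener (f : ℝ → ℂ) : Prop :=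
  Summable (fun n : ℤ => ‖fCoeff f n‖) ∧
    ∀ ξ : ℝ, f ξ = ∑' n : ℤ, fCoeff f n * Complex.exp (Complex.I * (n : ℂ) * (ξ : ℂ))

/-- Fourier transform of a (signed) measure on `ℤ`. -/
def fhat (μ : ℤ → ℝ) (ξ : ℝ) : ℂ :=
  ∑' k : ℤ, (μ k : ℂ) * Complex.exp (Complex.I * (k : ℂ) * (ξ : ℂ))

/-- Total variation distance between two signed measures on `ℤ`. -/
def dTV (μ ν : ℤ → ℝ) : ℝ := ∑' k : ℤ, |μ k - ν k|

/-- Local distance between two signed measures on `ℤ`. -/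
def dLoc (μ ν : ℤ → ℝ) : ℝ := ⨆ k : ℤ, |μ k - ν k|

/-- Measure of the half-line `[k, +∞)`. -/
def tailMeas (μ : ℤ → ℝ) (k : ℤ) : ℝ := ∑' j : ℤ, if k ≤ j then μ j else 0

/-- Kolmogorov distance between two signed measures on `ℤ`. -/
def dKol (μ ν : ℤ → ℝ) : ℝ := ⨆ k : ℤ, |tailMeas μ k - tailMeas ν k|

/-- A signed measure on `ℤ` with finite total variation. -/
def IsFiniteSigned (μ : ℤ → ℝ) : Prop := Summable fun k => |μ k|

/-- A probability measure on `ℤ`. -/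
def IsProb (μ : ℤ → ℝ) : Prop := (∀ k, 0 ≤ μ k) ∧ Summable μ ∧ (∑' k, μ k) = 1

/-- Lévy–Khintchine exponent of an infinitely divisible law on `ℤ` with a second moment,
whose support is not contained in a proper sublattice of `ℤ`: `φ` is `2π`-periodic, twice
continuously differentiable, `e^{λφ}` is the Fourier transform of a probability measure
on `ℤ` for every `λ > 0`, and `φ(ξ) = imξ − σ²ξ²/2 + o(ξ²)` near `0` with `σ² > 0`. -/
structure LevyExponent where
  φ : ℝ → ℂ
  m : ℝ
  σ2 : ℝ
  periodic : Function.Periodic φ (2 * Real.pi)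
  smooth : ContDiff ℝ 2 φ
  σ2_pos : 0 < σ2
  taylor : (fun ξ : ℝ => φ ξ - (Complex.I * (m : ℂ) * (ξ : ℂ) - (σ2 : ℂ) * (ξ : ℂ) ^ 2 / 2))
      =o[nhds 0] fun ξ : ℝ => ξ ^ 2
  isCharFun : ∀ lam : ℝ, 0 < lam → ∃ p : ℤ → ℝ, IsProb p ∧
      ∀ ξ : ℝ, Complex.exp ((lam : ℂ) * φ ξ) = fhat p ξ

/-- `M = −sup_{ξ∈[−π,π], ξ≠0} Re(φ(ξ))/ξ²`. -/
def Mconst (φ : ℝ → ℂ) : ℝ :=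
  -sSup ((fun ξ : ℝ => (φ ξ).re / ξ ^ 2) '' (Set.Icc (-Real.pi) Real.pi \ {0}))

/-- `γ(ε) = sup_{ξ∈[−ε,ε]} |φ″(ξ) + σ²|`. -/
def gammaB (φ : ℝ → ℂ) (σ2 ε : ℝ) : ℝ :=
  sSup ((fun ξ : ℝ => ‖iteratedDeriv 2 φ ξ + (σ2 : ℂ)‖) '' Set.Icc (-ε) ε)

/-- Supremum norm of `φ′` on the torus. -/
def derivSup (φ : ℝ → ℂ) : ℝ :=
  sSup ((fun ξ : ℝ => ‖deriv φ ξ‖) '' Set.Icc (-Real.pi) Real.pi)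

/-- Supremum norm of a function on the torus. -/
def supT (f : ℝ → ℂ) : ℝ := sSup ((fun ξ : ℝ => ‖f ξ‖) '' Set.Icc (-Real.pi) Real.pi)

/-- The piecewise-linear cut function: `1` on `[−ε/2, ε/2]`, `0` outside `[−ε, ε]`,
linear interpolation in between. -/
def cut (ε ξ : ℝ) : ℝ :=
  if |ξ| ≤ ε / 2 then 1 else if ε ≤ |ξ| then 0 else 2 * (ε - |ξ|) / ε

/-- Hermite functions `G_r(x) = (d/dx)^r e^{−x²/2}`. -/
def hermiteG (r : ℕ) (x : ℝ) : ℝ := iteratedDeriv r (fun t : ℝ => Real.exp (-(t ^ 2) / 2)) x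

/-- Hypothesis (H1), uniform version: `ψ_n(ξ) − χ_n(ξ) = β_n (iξ)^{r+1}(1+o_ξ(1))`,
with `o_ξ(1)` uniform in `n`. -/
def H1unif (r : ℕ) (ψn χn : ℕ → ℝ → ℂ) (βn : ℕ → ℝ) : Prop :=
  ∀ δ : ℝ, 0 < δ → ∃ η : ℝ, 0 < η ∧ ∀ n : ℕ, ∀ ξ : ℝ, |ξ| < η →
    ‖ψn n ξ - χn n ξ - (βn n : ℂ) * (Complex.I * (ξ : ℂ)) ^ (r + 1)‖ ≤ δ * |ξ| ^ (r + 1)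

/-- Hypothesis (H1), limiting version: `ψ(ξ) − χ(ξ) = β (iξ)^{r+1}(1+o_ξ(1))` as `ξ → 0`. -/
def H1lim (r : ℕ) (ψ χ : ℝ → ℂ) (β : ℝ) : Prop :=
  (fun ξ : ℝ => ψ ξ - χ ξ - (β : ℂ) * (Complex.I * (ξ : ℂ)) ^ (r + 1))
    =o[nhds 0] fun ξ : ℝ => |ξ| ^ (r + 1)

/-- Hypothesis (H2), uniform version:
`ψ_n′(ξ) − χ_n′(ξ) = i(r+1)β_n(iξ)^r + i(r+2)γ_n(iξ)^{r+1}(1+o_ξ(1))`,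
with `o_ξ(1)` uniform in `n`. -/
def H2unif (r : ℕ) (ψn χn : ℕ → ℝ → ℂ) (βn γn : ℕ → ℝ) : Prop :=
  ∀ δ : ℝ, 0 < δ → ∃ η : ℝ, 0 < η ∧ ∀ n : ℕ, ∀ ξ : ℝ, |ξ| < η →
    ‖deriv (fun t => ψn n t - χn n t) ξ -
        (Complex.I * ((r : ℂ) + 1) * (βn n : ℂ) * (Complex.I * (ξ : ℂ)) ^ r +
          Complex.I * ((r : ℂ) + 2) * (γn n : ℂ) * (Complex.I * (ξ : ℂ)) ^ (r + 1))‖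
      ≤ δ * |ξ| ^ (r + 1)

/-- Hypothesis (H2), limiting version. -/
def H2lim (r : ℕ) (ψ χ : ℝ → ℂ) (β γ : ℝ) : Prop :=
  (fun ξ : ℝ => deriv (fun t => ψ t - χ t) ξ -
      (Complex.I * ((r : ℂ) + 1) * (β : ℂ) * (Complex.I * (ξ : ℂ)) ^ r +
        Complex.I * ((r : ℂ) + 2) * (γ : ℂ) * (Complex.I * (ξ : ℂ)) ^ (r + 1)))
    =o[nhds 0] fun ξ : ℝ => |ξ| ^ (r + 1)

/-- `C_k = (1/k!)·√((2π/3)·Γ(k+1/2))`. -/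
def Cconst (k : ℕ) : ℝ :=
  (1 / (Nat.factorial k : ℝ)) * Real.sqrt ((2 * Real.pi / 3) * Real.Gamma ((k : ℝ) + 1 / 2))

/-- `β_{r+1}(ε)`: supremum of the `(r+1)`-th derivative of `ψ−χ` on `[−ε,ε]`. -/
def betaSup (r : ℕ) (ε : ℝ) (ψ χ : ℝ → ℂ) : ℝ :=
  sSup ((fun ξ : ℝ =>
    ‖iteratedDerivWithin (r + 1) (fun t => ψ t - χ t) (Set.Icc (-ε) ε) ξ‖) '' Set.Icc (-ε) ε)

/-- Right derivative of `1 - cut ε`. -/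
def cutD (ε x : ℝ) : ℝ :=
  if x < -ε then 0 else if x < -(ε / 2) then -(2 / ε) else if x < ε / 2 then 0
    else if x < ε then 2 / ε else 0

/-- The support of `cutD`. -/
def cutS (ε : ℝ) : Set ℝ := Set.Ico (-ε) (-(ε / 2)) ∪ Set.Ico (ε / 2) ε

lemma one_sub_cut (ε x : ℝ) (hε : 0 < ε) :
    1 - cut ε x = max 0 (min 1 (2 * |x| / ε - 1)) := by
  unfold cut
  split_ifs with h1 h2
  · have : 2 * |x| / ε - 1 ≤ 0 := by
      rw [sub_nonpos, div_le_one hε]; linarith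
    rw [min_eq_right (by linarith), max_eq_left this]; ring
  · have : 1 ≤ 2 * |x| / ε - 1 := by
      rw [le_sub_iff_add_le, le_div_iff₀ hε]; linarith
    rw [min_eq_left this]; norm_num
  · push Not at h1 h2
    have a : 2 * |x| / ε - 1 ≤ 1 := by
      rw [sub_le_iff_le_add, div_le_iff₀ hε]; linarith
    have b : 0 ≤ 2 * |x| / ε - 1 := by
      rw [sub_nonneg, le_div_iff₀ hε]; linarith
    rw [min_eq_right a, max_eq_right b]
    field_simp
    ring

lemma one_sub_cut_cont (ε : ℝ) (hε : 0 < ε) : Continuous fun x => 1 - cut ε x := by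
  simp_rw [one_sub_cut ε _ hε]
  fun_prop

lemma cut_nonneg (ε x : ℝ) (hε : 0 < ε) : 0 ≤ 1 - cut ε x := by
  rw [one_sub_cut ε x hε]; exact le_max_left _ _

lemma cut_le_one (ε x : ℝ) (hε : 0 < ε) : 1 - cut ε x ≤ 1 := by
  rw [one_sub_cut ε x hε]; exact max_le zero_le_one (min_le_left _ _)

lemma one_sub_cut_deriv (ε x : ℝ) (hε : 0 < ε) :
    HasDerivWithinAt (fun x => 1 - cut ε x) (cutD ε x) (Set.Ioi x) x := by
  have key : ∀ (a c : ℝ) (y : ℝ), x < y → (∀ t, x ≤ t → t < y → 1 - cut ε t = a * t + c) →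
      HasDerivWithinAt (fun x => 1 - cut ε x) a (Set.Ioi x) x := by
    intro a c y hy h
    have h0 : HasDerivAt (fun t : ℝ => a * t + c) a x := by
      simpa using ((hasDerivAt_id x).const_mul a).add_const c
    refine h0.hasDerivWithinAt.congr_of_eventuallyEq ?_ (h x le_rfl hy)
    have : Set.Ioo x y ∈ 𝓝[>] x := Ioo_mem_nhdsGT hy
    filter_upwards [this] with t ht using h t ht.1.le ht.2
  unfold cutD
  split_ifs with h1 h2 h3 h4
  · refine key 0 1 (-ε) h1 fun t _ ht => ?_
    have : |t| = -t := abs_of_neg (by linarith)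
    unfold cut
    rw [if_neg (by rw [this]; linarith), if_pos (by rw [this]; linarith)]; ring
  · refine key _ (-1) _ h2 fun t ht ht2 => ?_
    have : |t| = -t := abs_of_neg (by linarith)
    unfold cut
    rw [if_neg (by rw [this]; linarith)]
    split_ifs with h
    · have : t = -ε := by linarith
      rw [this]; field_simp; ring
    · rw [this]; field_simp; ring
  · refine key _ 0 _ h3 fun t ht ht2 => ?_
    unfold cut
    rw [if_pos (abs_le.2 ⟨by linarith, by linarith⟩)]; ring
  · refine key _ (-1) _ h4 fun t ht ht2 => ?_
    have : |t| = t := abs_of_nonneg (by linarith)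
    unfold cut
    split_ifs with h h'
    · have : t = ε / 2 := by linarith
      rw [this]; field_simp; ring
    · linarith
    · rw [this]; field_simp; ring
  · refine key 0 1 (x + 1) (by linarith) fun t ht _ => ?_
    have : |t| = t := abs_of_nonneg (by linarith)
    unfold cut
    rw [if_neg (by rw [this]; linarith), if_pos (by rw [this]; linarith)]; ring

lemma cutD_meas (ε : ℝ) : Measurable (cutD ε) := by
  unfold cutD
  refine Measurable.ite measurableSet_Iio measurable_const ?_
  refine Measurable.ite measurableSet_Iio measurable_const ?_
  refine Measurable.ite measurableSet_Iio measurable_const ?_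
  exact Measurable.ite measurableSet_Iio measurable_const measurable_const

lemma cutS_meas (ε : ℝ) : MeasurableSet (cutS ε) := measurableSet_Ico.union measurableSet_Ico

lemma abs_cutD (ε x : ℝ) (hε : 0 < ε) :
    |cutD ε x| = (cutS ε).indicator (fun _ => 2 / ε) x := by
  have h : 0 ≤ 2 / ε := by positivity
  unfold cutD cutS
  by_cases hx : x ∈ Set.Ico (-ε) (-(ε / 2)) ∪ Set.Ico (ε / 2) ε
  · rw [Set.indicator_of_mem hx]
    rcases hx with ⟨a, b⟩ | ⟨a, b⟩
    · rw [if_neg (by linarith), if_pos b, abs_neg, abs_of_nonneg h]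
    · rw [if_neg (by linarith), if_neg (by linarith), if_neg (by linarith), if_pos b,
        abs_of_nonneg h]
  · rw [Set.indicator_of_notMem hx]
    simp only [Set.mem_union, Set.mem_Ico, not_or, not_and, not_lt] at hx
    split_ifs <;> simp <;> grind

lemma cutS_vol (ε : ℝ) (hε : 0 < ε) : volume.real (cutS ε) ≤ ε := by
  unfold cutS
  refine (measureReal_union_le _ _).trans ?_
  rw [Real.volume_real_Ico_of_le (by linarith), Real.volume_real_Ico_of_le (by linarith)]
  linarith

lemma fCoeff_eq (f : ℝ → ℂ) (n : ℤ) (h : -Real.pi < Real.pi) :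
    fCoeff f n = fourierCoeffOn h f n := by
  rw [fourierCoeffOn_eq_integral, fCoeff]
  have : ∀ x : ℝ, f x * Complex.exp (-(Complex.I * (n : ℂ) * (x : ℂ)))
      = fourier (-n) (x : AddCircle (Real.pi - -Real.pi)) • f x := by
    intro x
    rw [fourier_coe_apply, smul_eq_mul, mul_comm]
    congr 2
    have : (Real.pi : ℂ) ≠ 0 := by exact_mod_cast Real.pi_ne_zero
    push_cast
    rw [sub_neg_eq_add, ← two_mul]
    field_simp
  simp_rw [this]
  rw [Complex.real_smul, div_eq_inv_mul]
  congr 1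
  push_cast
  ring

lemma hasSum_int_sq : HasSum (fun n : ℤ => |(n : ℝ)|⁻¹ ^ 2) ((Real.pi / Real.sqrt 3) ^ 2) := by
  have h1 := hasSum_zeta_two
  have h2 : HasSum (fun n : ℕ => (1 : ℝ) / ((n + 1 : ℕ) : ℝ) ^ 2) (π ^ 2 / 6) := by
    rw [hasSum_nat_add_iff (f := fun n : ℕ => (1 : ℝ) / (n : ℝ) ^ 2)]
    simpa using h1
  have := HasSum.of_nat_of_neg_add_one (f := fun n : ℤ => |(n : ℝ)|⁻¹ ^ 2) (m := π ^ 2 / 6)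
    (m' := π ^ 2 / 6) (by simpa using h1) (by
      convert h2 using 2 with n
      rw [inv_pow, sq_abs]; push_cast; rw [one_div]; congr 1; ring)
  convert this using 1
  rw [div_pow, Real.sq_sqrt (by norm_num)]; ring

lemma wiener_le (f g : ℝ → ℂ) (A : ℝ) (hA : 0 ≤ A) (hf : Continuous f)
    (hper : f Real.pi = f (-Real.pi))
    (hd : ∀ x, HasDerivWithinAt f (g x) (Set.Ioi x) x)
    (hL : MemLp g 2 (volume.restrict (Set.Ioc (-Real.pi) Real.pi)))
    (hI : ∫ x in (-Real.pi)..Real.pi, ‖g x‖ ^ 2 ≤ 2 * Real.pi * A ^ 2) :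
    wienerNorm f ≤ ‖fCoeff f 0‖ + Real.pi / Real.sqrt 3 * A := by
  have hπ : -Real.pi < Real.pi := by linarith [Real.pi_pos]
  have hpar := hasSum_sq_fourierCoeffOn hπ hL
  simp_rw [← fCoeff_eq] at hpar
  set J := (Real.pi - -Real.pi)⁻¹ • ∫ x in (-Real.pi)..Real.pi, ‖g x‖ ^ 2 with hJ
  have hJ0 : 0 ≤ J := hpar.nonneg fun _ => by positivity
  have hJA : J ≤ A ^ 2 := by
    rw [hJ, smul_eq_mul, inv_mul_le_iff₀ (by linarith)]
    linarith
  have hint : IntervalIntegrable g volume (-Real.pi) Real.pi := by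
    rw [intervalIntegrable_iff_integrableOn_Ioc_of_le hπ.le]
    exact hL.integrable (by norm_num)
  have hco : ∀ n : ℤ, n ≠ 0 → ‖fCoeff f n‖ = |(n : ℝ)|⁻¹ * ‖fCoeff g n‖ := by
    intro n hn
    have := fourierCoeffOn_of_hasDeriv_right hπ hn hf.continuousOn (fun x _ => hd x) hint
    rw [← fCoeff_eq, ← fCoeff_eq, hper, sub_self, mul_zero, zero_sub] at this
    rw [this]
    have h2 : ((Real.pi : ℂ) - ((-Real.pi : ℝ) : ℂ)) = ((2 * Real.pi : ℝ) : ℂ) := by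
      push_cast; ring
    rw [h2]
    simp only [norm_mul, norm_neg, norm_div, norm_one, Complex.norm_real, Complex.norm_I,
      Complex.norm_intCast, Complex.norm_ofNat, Real.norm_eq_abs, abs_of_pos Real.pi_pos]
    have : |(n : ℝ)| ≠ 0 := by simpa using hn
    have := Real.pi_ne_zero
    rw [abs_of_pos (by positivity : (0 : ℝ) < 2)]
    field_simp
  obtain ⟨C, hC0, hC, hsum⟩ := Real.inner_le_Lp_mul_Lq_hasSum_of_nonneg
    (p := 2) (q := 2) (f := fun n : ℤ => |(n : ℝ)|⁻¹) (g := fun n : ℤ => ‖fCoeff g n‖)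
    (A := Real.pi / Real.sqrt 3) (B := Real.sqrt J) Real.HolderConjugate.two_two
    (by positivity) (by positivity) (fun _ => by positivity) (fun _ => by positivity)
    (by simpa only [Real.rpow_two] using hasSum_int_sq)
    (by simpa only [Real.rpow_two, Real.sq_sqrt hJ0] using hpar)
  have h0 : HasSum (fun n : ℤ => if n = 0 then ‖fCoeff f 0‖ else 0) ‖fCoeff f 0‖ :=
    hasSum_ite_eq 0 _
  have htot := h0.add hsum
  have heq : (fun n : ℤ => (if n = 0 then ‖fCoeff f 0‖ else 0) + |(n : ℝ)|⁻¹ * ‖fCoeff g n‖)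
      = fun n => ‖fCoeff f n‖ := by
    funext n
    by_cases hn : n = 0
    · subst hn; simp
    · rw [if_neg hn, hco n hn, zero_add]
  rw [heq] at htot
  unfold wienerNorm
  rw [htot.tsum_eq]
  have : Real.sqrt J ≤ A := Real.sqrt_le_iff.2 ⟨hA, hJA⟩
  have : Real.pi / Real.sqrt 3 * Real.sqrt J ≤ Real.pi / Real.sqrt 3 * A := by gcongr
  linarith

lemma exp_norm_le_one (L : LevyExponent) (l : ℝ) (hl : 0 < l) (x : ℝ) :
    ‖Complex.exp ((l : ℂ) * L.φ x)‖ ≤ 1 := by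
  obtain ⟨p, ⟨h0, hs, h1⟩, hp⟩ := L.isCharFun l hl
  rw [hp, fhat, ← h1]
  have : ∀ k : ℤ, ‖(p k : ℂ) * Complex.exp (Complex.I * (k : ℂ) * (x : ℂ))‖ = p k := by
    intro k
    rw [norm_mul, Complex.norm_real, Real.norm_eq_abs, abs_of_nonneg (h0 k), Complex.norm_exp]
    simp
  have h2 : Summable fun k : ℤ => ‖(p k : ℂ) * Complex.exp (Complex.I * (k : ℂ) * (x : ℂ))‖ := by
    simpa only [this] using hs
  exact (norm_tsum_le_tsum_norm h2).trans (by simp only [this]; exact le_rfl)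

lemma re_nonpos (L : LevyExponent) (x : ℝ) : (L.φ x).re ≤ 0 := by
  have := exp_norm_le_one L 1 one_pos x
  rw [Complex.norm_exp] at this
  simpa using this

lemma exp_bound (L : LevyExponent) (l ε x : ℝ) (hl : 0 < l) (hε : 0 < ε)
    (hx : x ∈ Set.Icc (-Real.pi) Real.pi) (hx2 : ε / 2 ≤ |x|) :
    ‖Complex.exp ((l : ℂ) * L.φ x)‖ ≤ Real.exp (-(l * Mconst L.φ * ε ^ 2) / 4) := by
  have hx0 : x ≠ 0 := by
    intro h; rw [h, abs_zero] at hx2; linarith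
  have hnp : ∀ y ∈ ((fun ξ : ℝ => (L.φ ξ).re / ξ ^ 2) '' (Set.Icc (-Real.pi) Real.pi \ {0})),
      y ≤ 0 := by
    rintro _ ⟨y, _, rfl⟩
    exact div_nonpos_of_nonpos_of_nonneg (re_nonpos L y) (sq_nonneg y)
  have hM : 0 ≤ Mconst L.φ := by
    unfold Mconst
    linarith [Real.sSup_nonpos hnp]
  have h1 : (L.φ x).re / x ^ 2 ≤ -Mconst L.φ := by
    unfold Mconst
    rw [neg_neg]
    exact le_csSup ⟨0, hnp⟩ ⟨x, ⟨hx, hx0⟩, rfl⟩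
  have hxs : 0 < x ^ 2 := by positivity
  rw [div_le_iff₀ hxs] at h1
  rw [Complex.norm_exp, Complex.re_ofReal_mul]
  apply Real.exp_le_exp.2
  have h2 : (ε / 2) ^ 2 ≤ x ^ 2 := by
    rw [← sq_abs x]; gcongr
  have h3 : Mconst L.φ * (ε / 2) ^ 2 ≤ Mconst L.φ * x ^ 2 := by gcongr
  have h4 : l * (L.φ x).re ≤ l * -(Mconst L.φ * (ε / 2) ^ 2) := by gcongr; linarith
  linarith

lemma l2_bound (ε B E : ℝ) (hε0 : 0 < ε) (hεπ : ε ≤ Real.pi) (hB : 0 ≤ B) :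
    ∫ x in (-Real.pi)..Real.pi, ((|cutD ε x| + B) * E) ^ 2 ≤
      2 * Real.pi * ((Real.sqrt (2 / (Real.pi * ε)) + B) * E) ^ 2 := by
  have hπ : -Real.pi < Real.pi := by linarith [Real.pi_pos]
  have hp := Real.pi_pos
  set K := (2 / ε) ^ 2 + 2 * B * (2 / ε) with hK
  have hK0 : 0 ≤ K := by positivity
  have heq : ∀ x, ((|cutD ε x| + B) * E) ^ 2
      = ((cutS ε).indicator (fun _ => K) x + B ^ 2) * E ^ 2 := by
    intro x
    rw [abs_cutD ε x hε0]
    by_cases hx : x ∈ cutS ε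
    · rw [Set.indicator_of_mem hx, Set.indicator_of_mem hx]; ring
    · rw [Set.indicator_of_notMem hx, Set.indicator_of_notMem hx]; ring
  have hfin : volume (cutS ε) ≠ ⊤ := by
    unfold cutS
    exact ((measure_union_lt_top (by simp) (by simp))).ne
  have hind : Integrable ((cutS ε).indicator fun _ => K) volume :=
    (integrable_indicator_iff (cutS_meas ε)).2 (integrableOn_const hfin)
  have hI : ∫ x in (-Real.pi)..Real.pi, (cutS ε).indicator (fun _ => K) x ≤ ε * K := by
    rw [intervalIntegral.integral_of_le hπ.le]
    refine (setIntegral_le_integral hind (Eventually.of_forall fun x => ?_)).trans ?_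
    · exact Set.indicator_nonneg (fun _ _ => hK0) x
    · rw [integral_indicator (cutS_meas ε), setIntegral_const, smul_eq_mul]
      gcongr
      exact cutS_vol ε hε0
  simp_rw [heq]
  rw [intervalIntegral.integral_mul_const, intervalIntegral.integral_add
    hind.intervalIntegrable (by simp), intervalIntegral.integral_const, smul_eq_mul]
  set A := Real.sqrt (2 / (Real.pi * ε)) with hA
  have hA2 : A ^ 2 = 2 / (Real.pi * ε) := Real.sq_sqrt (by positivity)
  have hA1 : 1 / Real.pi ≤ A := by
    apply Real.le_sqrt_of_sq_le
    rw [div_pow, div_le_div_iff₀ (by positivity) (by positivity)]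
    nlinarith
  have e1 : ε * K = 2 * Real.pi * (A ^ 2 + 2 * B * (1 / Real.pi)) := by
    rw [hA2, hK]; field_simp
  have e2 : 2 * Real.pi * (2 * B * (1 / Real.pi)) ≤ 2 * Real.pi * (2 * B * A) := by gcongr
  rw [mul_pow, ← mul_assoc]
  refine mul_le_mul_of_nonneg_right ?_ (sq_nonneg E)
  nlinarith

/-- Lemma 2.4: in the one-dimensional concentration setting, if `ε` is small enough so
that `γ(ε) ≤ σ²/2` and `λ ≥ 2/σ²`, then, with `c` the piecewise linear cut function,
`‖(1−c)e^{λφ}‖_A ≤ (1 + C_H(√(2/(πε)) + λ‖φ′‖_∞))·e^{−λMε²/4}`, where `C_H = π/√3`. -/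
theorem norm_estimate_outside_cut (L : LevyExponent) (ε lam : ℝ)
    (hε0 : 0 < ε) (hεπ : ε ≤ Real.pi)
    (hγ : gammaB L.φ L.σ2 ε ≤ L.σ2 / 2)
    (hlam : 2 / L.σ2 ≤ lam) :
    wienerNorm (fun ξ => (1 - (cut ε ξ : ℂ)) * Complex.exp ((lam : ℂ) * L.φ ξ)) ≤
      (1 + (Real.pi / Real.sqrt 3) *
          (Real.sqrt (2 / (Real.pi * ε)) + lam * derivSup L.φ)) *
        Real.exp (-(lam * Mconst L.φ * ε ^ 2) / 4) := by
  have hp := Real.pi_pos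
  have hπ : -Real.pi < Real.pi := by linarith
  have hl : 0 < lam := lt_of_lt_of_le (div_pos two_pos L.σ2_pos) hlam
  have hφc : Continuous L.φ := L.smooth.continuous
  have hφd : Differentiable ℝ L.φ := L.smooth.differentiable (by norm_num)
  have hdc : Continuous (deriv L.φ) := L.smooth.continuous_deriv (by norm_num)
  set E := Real.exp (-(lam * Mconst L.φ * ε ^ 2) / 4) with hE
  have hE0 : 0 ≤ E := (Real.exp_pos _).le
  set D := derivSup L.φ with hD
  have hDle : ∀ x ∈ Set.Icc (-Real.pi) Real.pi, ‖deriv L.φ x‖ ≤ D := fun x hx =>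
    le_csSup (isCompact_Icc.image hdc.norm).bddAbove ⟨x, hx, rfl⟩
  have hD0 : 0 ≤ D := (norm_nonneg _).trans (hDle 0 ⟨by linarith, hp.le⟩)
  set A := Real.sqrt (2 / (Real.pi * ε)) with hA
  set f : ℝ → ℂ := fun ξ => (1 - (cut ε ξ : ℂ)) * Complex.exp ((lam : ℂ) * L.φ ξ) with hf
  set g : ℝ → ℂ := fun ξ => (cutD ε ξ : ℂ) * Complex.exp ((lam : ℂ) * L.φ ξ) +
    (1 - (cut ε ξ : ℂ)) * (Complex.exp ((lam : ℂ) * L.φ ξ) * ((lam : ℂ) * deriv L.φ ξ)) with hg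
  have hkc : Continuous fun x : ℝ => (1 - (cut ε x : ℂ)) := by
    have := Complex.continuous_ofReal.comp (one_sub_cut_cont ε hε0)
    refine this.congr fun x => ?_
    simp
  have hfc : Continuous f := by rw [hf]; fun_prop
  have hkn : ∀ x, ‖(1 - (cut ε x : ℂ))‖ = 1 - cut ε x := by
    intro x
    rw [← Complex.ofReal_one, ← Complex.ofReal_sub, Complex.norm_real, Real.norm_eq_abs,
      abs_of_nonneg (cut_nonneg ε x hε0)]
  have hkle : ∀ x, ‖(1 - (cut ε x : ℂ))‖ ≤ 1 := fun x => by
    rw [hkn]; exact cut_le_one ε x hε0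
  have hper : f Real.pi = f (-Real.pi) := by
    have h1 : L.φ Real.pi = L.φ (-Real.pi) := by
      rw [← L.periodic (-Real.pi)]; congr 1; ring
    have h2 : cut ε (-Real.pi) = cut ε Real.pi := by
      unfold cut; rw [abs_neg]
    simp only [hf, h1, h2]
  have hd : ∀ x, HasDerivWithinAt f (g x) (Set.Ioi x) x := by
    intro x
    have h1 : HasDerivWithinAt (fun x : ℝ => (1 - (cut ε x : ℂ))) (cutD ε x : ℂ) (Set.Ioi x) x := by
      have := (one_sub_cut_deriv ε x hε0).ofReal_comp
      simpa using this
    have h2 : HasDerivAt (fun x => Complex.exp ((lam : ℂ) * L.φ x))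
        (Complex.exp ((lam : ℂ) * L.φ x) * ((lam : ℂ) * deriv L.φ x)) x :=
      ((hφd x).hasDerivAt.const_mul (lam : ℂ)).cexp
    exact h1.mul h2.hasDerivWithinAt
  have hgm : Measurable g := by
    have := cutD_meas ε
    have := hkc.measurable
    have := hφc.measurable
    have := hdc.measurable
    rw [hg]
    fun_prop
  have hgb : ∀ x ∈ Set.Icc (-Real.pi) Real.pi, ‖g x‖ ≤ (|cutD ε x| + lam * D) * E := by
    intro x hx
    by_cases hx2 : ε / 2 ≤ |x|
    · have he := exp_bound L lam ε x hl hε0 hx hx2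
      simp only [hg]
      refine (norm_add_le _ _).trans ?_
      rw [add_mul]
      refine add_le_add ?_ ?_
      · rw [norm_mul, Complex.norm_real, Real.norm_eq_abs]
        gcongr
      · rw [norm_mul, norm_mul, norm_mul, Complex.norm_real, Real.norm_eq_abs, abs_of_pos hl]
        calc _ ≤ 1 * (E * (lam * D)) := by
              gcongr
              · exact hkle x
              · exact hDle x hx
          _ = _ := by ring
    · push Not at hx2
      have hc : cut ε x = 1 := by unfold cut; rw [if_pos hx2.le]
      have hx3 := abs_lt.1 hx2
      have hcd : cutD ε x = 0 := by
        unfold cutD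
        rw [if_neg (by linarith), if_neg (by linarith), if_pos hx3.2]
      simp only [hg, hc, hcd]
      simp
      positivity
  have hcdb : ∀ x, |cutD ε x| ≤ 2 / ε := by
    intro x
    rw [abs_cutD ε x hε0]
    exact Set.indicator_le_self' (fun _ _ => by positivity) x
  have hL : MemLp g 2 (volume.restrict (Set.Ioc (-Real.pi) Real.pi)) := by
    refine MemLp.of_bound hgm.aestronglyMeasurable ((2 / ε + lam * D) * E) ?_
    filter_upwards [ae_restrict_mem measurableSet_Ioc] with x hx
    refine (hgb x (Set.Ioc_subset_Icc_self hx)).trans ?_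
    gcongr
    exact hcdb x
  have hint2 : IntervalIntegrable (fun x => ((|cutD ε x| + lam * D) * E) ^ 2) volume
      (-Real.pi) Real.pi := by
    rw [intervalIntegrable_iff_integrableOn_Ioc_of_le hπ.le]
    have hm : Measurable (fun x => ((|cutD ε x| + lam * D) * E) ^ 2) := by
      have := (cutD_meas ε).abs
      fun_prop
    refine Integrable.of_bound hm.aestronglyMeasurable (((2 / ε + lam * D) * E) ^ 2)
      (Eventually.of_forall fun x => ?_)
    rw [Real.norm_eq_abs, abs_of_nonneg (sq_nonneg _)]
    gcongr
    exact hcdb x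
  have hI : ∫ x in (-Real.pi)..Real.pi, ‖g x‖ ^ 2 ≤ 2 * Real.pi * ((A + lam * D) * E) ^ 2 := by
    refine le_trans ?_ (l2_bound ε (lam * D) E hε0 hεπ (by positivity))
    refine intervalIntegral.integral_mono_on hπ.le ?_ hint2 fun x hx => ?_
    · rw [intervalIntegrable_iff_integrableOn_Ioc_of_le hπ.le]
      exact hL.integrable_norm_pow (by norm_num)
    · have := hgb x hx
      gcongr
  have hmain := wiener_le f g ((A + lam * D) * E) (by positivity) hfc hper hd hL hI
  have h0 : ‖fCoeff f 0‖ ≤ E := by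
    unfold fCoeff
    rw [norm_div, Complex.norm_real, Real.norm_eq_abs, abs_of_pos (by positivity),
      div_le_iff₀ (by positivity)]
    refine (intervalIntegral.norm_integral_le_of_norm_le_const (C := E) fun x hx => ?_).trans ?_
    · rw [Set.uIoc_of_le hπ.le] at hx
      have : ‖f x‖ ≤ E := by
        by_cases hx2 : ε / 2 ≤ |x|
        · have he := exp_bound L lam ε x hl hε0 (Set.Ioc_subset_Icc_self hx) hx2
          simp only [hf]
          rw [norm_mul]
          calc _ ≤ 1 * E := by
                gcongr
                exact hkle x
            _ = E := one_mul E
        · push Not at hx2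
          have hc : cut ε x = 1 := by unfold cut; rw [if_pos hx2.le]
          simp only [hf, hc]
          simpa using hE0
      simpa using this
    · rw [sub_neg_eq_add, ← two_mul, abs_of_pos (by positivity)]
  calc _ ≤ _ := hmain
    _ ≤ E + Real.pi / Real.sqrt 3 * ((A + lam * D) * E) := by linarith
    _ = _ := by ring

end
end

section
/- In the one-dimensional concentration setting, fix an integer r ≥ 0 and let ψ, χ ∈ A(𝕋) be (r+1) times continuously differentiable on [−ε,ε] with (ψ−χ)^{(s)}(0) = 0 for all 0 ≤ s ≤ r; set β_{r+1}(ε) = sup_{ξ∈[−ε,ε]} |(ψ−χ)^{(r+1)}(ξ)|. Let ε be small enough so that γ(ε) ≤ σ²/2 and let λ ≥ 2/σ². With c the piecewise linear cut function equal to 1 on [−ε/2,ε/2] and 0 outside [−ε,ε], one has ‖c·(ψ−χ)·e^{λφ}‖_A ≤ C_{r+1}·β_{r+1}(ε)·(ε^{−1} + √(5(r+1))) / (σ²λ/2)^{r/2+1/4}, where C_{r+1} = (1/(r+1)!)·√((2π/3)·Γ(r+3/2)). -/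
open scoped Real
open MeasureTheory Filter Asymptotics Topology

noncomputable section

lemma aux_q_hasSum : ∃ S : ℝ, HasSum (fun k : ℕ => 1 / (4 + (k : ℝ) ^ 2)) S ∧ S ≤ π ^ 2 / 9 := by
  have hz := hasSum_zeta_two
  have hle : ∀ k : ℕ, 1 / (4 + (k : ℝ) ^ 2) ≤
      1 / (k : ℝ) ^ 2 + ((if k = 0 then 1 / 4 else 0) + (if k = 1 then -(4 / 5) else 0)) := by
    intro k
    rcases k with _ | _ | k
    · norm_num
    · norm_num
    · simp only [Nat.add_eq_zero_iff, one_ne_zero, and_false, if_false]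
      rw [if_neg (by omega)]
      simp only [add_zero]
      apply one_div_le_one_div_of_le
      · positivity
      · linarith
  have h2 : HasSum (fun k : ℕ => 1 / (k : ℝ) ^ 2 +
      ((if k = 0 then (1 : ℝ) / 4 else 0) + (if k = 1 then -(4 / 5) else 0)))
      (π ^ 2 / 6 + (1 / 4 + -(4 / 5))) :=
    hz.add ((hasSum_ite_eq 0 _).add (hasSum_ite_eq 1 _))
  have hs : Summable (fun k : ℕ => 1 / (4 + (k : ℝ) ^ 2)) :=
    Summable.of_nonneg_of_le (fun k => by positivity) hle h2.summable
  refine ⟨_, hs.hasSum, (hasSum_le hle hs.hasSum h2).trans ?_⟩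
  have := Real.pi_lt_d4
  nlinarith [Real.pi_pos]

lemma aux_wsum (x : ℝ) (s : Finset ℤ) :
    ∑ n ∈ s, 1 / (4 + ((n : ℝ) - x) ^ 2) ≤ 2 * π ^ 2 / 9 := by
  obtain ⟨S, hS, hSle⟩ := aux_q_hasSum
  have hrec := HasSum.int_rec hS hS
  have key : ∀ m : ℤ, 1 / (4 + (((m + (⌊x⌋ + 1) : ℤ) : ℝ) - x) ^ 2) ≤
      (Int.rec (fun k : ℕ => 1 / (4 + (k : ℝ) ^ 2)) (fun k : ℕ => 1 / (4 + (k : ℝ) ^ 2)) m : ℝ) := by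
    intro m
    have h1 := Int.floor_le x
    have h2 := Int.lt_floor_add_one x
    rcases m with k | k
    · have hk : (0 : ℝ) ≤ k := Nat.cast_nonneg k
      apply one_div_le_one_div_of_le (by positivity)
      push_cast
      have : (k : ℝ) ≤ k + (⌊x⌋ + 1) - x := by linarith
      simp only [Int.ofNat_eq_natCast, Int.cast_natCast]
      nlinarith
    · have hk : (0 : ℝ) ≤ k := Nat.cast_nonneg k
      apply one_div_le_one_div_of_le (by positivity)
      push_cast [Int.cast_negSucc]
      have : (k : ℝ) ≤ -(-(k + 1) + (⌊x⌋ + 1) - x) := by linarith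
      nlinarith
  have h3 : Summable (fun m : ℤ => 1 / (4 + (((m + (⌊x⌋ + 1) : ℤ) : ℝ) - x) ^ 2)) :=
    Summable.of_nonneg_of_le (fun m => by positivity) key hrec.summable
  have h4 := hasSum_le key h3.hasSum hrec
  have h5 := ((Equiv.addRight (⌊x⌋ + 1)).hasSum_iff
    (f := fun n : ℤ => 1 / (4 + ((n : ℝ) - x) ^ 2))).1 h3.hasSum
  have h6 := sum_le_hasSum s (fun n _ => by positivity) h5
  linarith

lemma aux_growth (ε C : ℝ) (j : ℕ) (G G' : ℝ → ℂ)
    (hG : ∀ x ∈ Set.Icc (-ε) ε, HasDerivWithinAt G (G' x) (Set.Icc (-ε) ε) x)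
    (h0 : G 0 = 0) (hb : ∀ x ∈ Set.Icc (-ε) ε, ‖G' x‖ ≤ C * |x| ^ j) :
    ∀ x ∈ Set.Icc (-ε) ε, ‖G x‖ ≤ C * |x| ^ (j + 1) / (j + 1) := by
  have pos : ∀ (G G' : ℝ → ℂ)
    (hG : ∀ x ∈ Set.Icc (-ε) ε, HasDerivWithinAt G (G' x) (Set.Icc (-ε) ε) x)
    (h0 : G 0 = 0) (hb : ∀ x ∈ Set.Icc (-ε) ε, ‖G' x‖ ≤ C * |x| ^ j),
    ∀ x ∈ Set.Icc 0 ε, ‖G x‖ ≤ C * x ^ (j + 1) / (j + 1) := by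
    intro G G' hG h0 hb y hy
    refine image_norm_le_of_norm_deriv_right_le_deriv_boundary (f := G) (f' := G')
      (B := fun x => C * x ^ (j + 1) / (j + 1))
      (B' := fun x => C * x ^ j) ?_ ?_ ?_ ?_ ?_ hy
    · intro x hx
      exact (hG x ⟨by linarith [hx.1, hx.2], hx.2⟩).continuousWithinAt.mono
        (Set.Icc_subset_Icc_left (by linarith [hx.1, hx.2]))
    · intro x hx
      refine (hG x ⟨by linarith [hx.1, hx.2], hx.2.le⟩).mono_of_mem_nhdsWithin ?_
      refine mem_nhdsWithin.2 ⟨Set.Iio ε, isOpen_Iio, hx.2, ?_⟩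
      intro y hy
      have h1 : y < ε := hy.1
      have h2 : x ≤ y := hy.2
      exact ⟨by linarith [hx.1, hx.2], h1.le⟩
    · simp [h0]
    · intro x
      have := ((hasDerivAt_pow (j + 1) x).const_mul C).div_const ((j : ℝ) + 1)
      refine this.congr_deriv ?_
      have hj : (j : ℝ) + 1 ≠ 0 := by positivity
      rw [Nat.add_sub_cancel]
      push_cast
      field_simp
    · intro x hx
      have := hb x ⟨by linarith [hx.1, hx.2], hx.2.le⟩
      rwa [abs_of_nonneg hx.1] at this
  intro x hx
  rcases le_total 0 x with h | h
  · have := pos G G' hG h0 hb x ⟨h, hx.2⟩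
    rwa [abs_of_nonneg h]
  · have hneg : ∀ y ∈ Set.Icc (-ε) ε, -y ∈ Set.Icc (-ε) ε :=
      fun y hy => ⟨by linarith [hy.2], by linarith [hy.1]⟩
    have := pos (fun y => G (-y)) (fun y => - G' (-y)) ?_ (by simpa using h0) ?_ (-x)
      ⟨by linarith, by linarith [hx.1]⟩
    · rw [abs_of_nonpos h]
      simpa using this
    · intro y hy
      have := (hG (-y) (hneg y hy)).scomp y (hasDerivAt_neg y).hasDerivWithinAt hneg
      simpa using! this
    · intro y hy
      simpa using hb (-y) (hneg y hy)

lemma aux_moment_integrable (K : ℝ) (hK : 0 < K) (j : ℕ) :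
    Integrable (fun x : ℝ => x ^ (2 * j) * Real.exp (-K * x ^ 2)) := by
  have := integrable_rpow_mul_exp_neg_mul_sq hK (s := ((2 * j : ℕ) : ℝ))
    (lt_of_lt_of_le (by norm_num) (Nat.cast_nonneg _))
  simpa only [Real.rpow_natCast] using this

lemma aux_moment (ε K : ℝ) (hε : 0 < ε) (hK : 0 < K) (j : ℕ) :
    ∫ x in (-ε)..ε, x ^ (2 * j) * Real.exp (-K * x ^ 2) ≤
      Real.Gamma (j + 1 / 2) * K ^ (-((j : ℝ) + 1 / 2)) := by
  rw [intervalIntegral.integral_of_le (by linarith)]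
  refine (setIntegral_le_integral (aux_moment_integrable K hK j)
    (Eventually.of_forall fun x => ?_)).trans_eq ?_
  · have : 0 ≤ x ^ (2 * j) := by rw [pow_mul]; positivity
    simp only [Pi.zero_apply]; positivity
  · have h1 := integral_comp_abs (f := fun x : ℝ => x ^ (2 * j) * Real.exp (-K * x ^ 2))
    have h2 : ∀ x : ℝ, |x| ^ (2 * j) * Real.exp (-K * |x| ^ 2) =
        x ^ (2 * j) * Real.exp (-K * x ^ 2) := by
      intro x; rw [pow_mul, sq_abs, ← pow_mul]
    simp only [h2] at h1
    rw [h1]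
    have h3 := integral_rpow_mul_exp_neg_mul_rpow (p := 2) (q := ((2 * j : ℕ) : ℝ)) (b := K)
      (by norm_num) (lt_of_lt_of_le (by norm_num) (Nat.cast_nonneg _)) hK
    simp only [Real.rpow_natCast, Real.rpow_two] at h3
    rw [h3]
    have e1 : (((2 * j : ℕ) : ℝ) + 1) / 2 = j + 1 / 2 := by push_cast; ring
    have e2 : -(((2 * j : ℕ) : ℝ) + 1) / 2 = -((j : ℝ) + 1 / 2) := by push_cast; ring
    rw [e1, e2]
    ring

lemma aux_bessel (f : ℝ → ℂ) (hf : MemLp f 2 (volume.restrict (Set.Ioc (-π) π))) :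
    HasSum (fun n : ℤ => ‖fCoeff f n‖ ^ 2) ((2 * π)⁻¹ * ∫ x in (-π)..π, ‖f x‖ ^ 2) := by
  have hab : -π < π := by linarith [Real.pi_pos]
  have h := hasSum_sq_fourierCoeffOn hab hf
  have e : π - -π = 2 * π := by ring
  rw [e, smul_eq_mul] at h
  convert h using 4 with n
  rw [fourierCoeffOn_eq_integral, fCoeff, div_eq_inv_mul, Complex.real_smul]
  congr 1
  · push_cast; ring
  · congr 1
    ext x
    rw [fourier_coe_apply, smul_eq_mul, mul_comm]
    congr 2
    have : (π : ℂ) ≠ 0 := by exact_mod_cast Real.pi_ne_zero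
    push_cast
    field_simp
    ring

lemma aux_cs (f f2 : ℝ → ℂ) (x : ℝ)
    (hf : MemLp f 2 (volume.restrict (Set.Ioc (-π) π)))
    (hf2 : MemLp f2 2 (volume.restrict (Set.Ioc (-π) π)))
    (hc : ∀ n : ℤ, ‖fCoeff f2 n‖ = |(n : ℝ) - x| * ‖fCoeff f n‖) :
    wienerNorm f ≤ Real.sqrt (π / 9 *
      (4 * (∫ x in (-π)..π, ‖f x‖ ^ 2) + ∫ x in (-π)..π, ‖f2 x‖ ^ 2)) := by
  have h1 := ((aux_bessel f hf).mul_left 4).add (aux_bessel f2 hf2)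
  apply Real.tsum_le_of_sum_le (fun n => norm_nonneg _)
  intro s
  apply Real.le_sqrt_of_sq_le
  have h2 := sum_le_hasSum s (fun n _ => by positivity) h1
  have h3 := aux_wsum x s
  have h4 := Finset.sum_sq_le_sum_mul_sum_of_sq_le_mul s
    (r := fun n : ℤ => ‖fCoeff f n‖) (f := fun n : ℤ => 1 / (4 + ((n : ℝ) - x) ^ 2))
    (g := fun n : ℤ => 4 * ‖fCoeff f n‖ ^ 2 + ‖fCoeff f2 n‖ ^ 2)
    (fun n _ => by positivity) (fun n _ => by positivity) (fun n _ => by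
      rw [hc n, mul_pow, sq_abs]
      have : 4 + ((n : ℝ) - x) ^ 2 ≠ 0 := by positivity
      apply le_of_eq
      field_simp)
  refine h4.trans ((mul_le_mul h3 h2 (Finset.sum_nonneg fun n _ => by positivity)
    (by positivity)).trans_eq ?_)
  have := Real.pi_ne_zero
  field_simp

/-- Derivative of the cut function away from its corners. -/
def auxCutd (ε ξ : ℝ) : ℝ :=
  if |ξ| ≤ ε / 2 then 0 else if 0 ≤ ξ then -2 / ε else 2 / ε

lemma aux_cut_eq (ε : ℝ) (hε : 0 < ε) (ξ : ℝ) :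
    cut ε ξ = max 0 (min 1 (2 * (ε - |ξ|) / ε)) := by
  unfold cut
  split_ifs with h1 h2
  · have : 1 ≤ 2 * (ε - |ξ|) / ε := by rw [le_div_iff₀ hε]; linarith
    rw [min_eq_left this]; norm_num
  · have : 2 * (ε - |ξ|) / ε ≤ 0 := div_nonpos_of_nonpos_of_nonneg (by linarith) hε.le
    rw [min_eq_right (by linarith), max_eq_left this]
  · push Not at h1 h2
    have h3 : 2 * (ε - |ξ|) / ε ≤ 1 := by rw [div_le_one hε]; linarith
    have h4 : 0 ≤ 2 * (ε - |ξ|) / ε := div_nonneg (by linarith) hε.le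
    rw [min_eq_right h3, max_eq_right h4]

lemma aux_cut_continuous (ε : ℝ) (hε : 0 < ε) : Continuous (cut ε) := by
  have : cut ε = fun ξ => max 0 (min 1 (2 * (ε - |ξ|) / ε)) := funext (aux_cut_eq ε hε)
  rw [this]
  fun_prop

lemma aux_cut_nonneg (ε : ℝ) (hε : 0 < ε) (ξ : ℝ) : 0 ≤ cut ε ξ := by
  rw [aux_cut_eq ε hε]; exact le_max_left _ _

lemma aux_cut_le_one (ε : ℝ) (hε : 0 < ε) (ξ : ℝ) : cut ε ξ ≤ 1 := by
  rw [aux_cut_eq ε hε]; exact max_le (by norm_num) (min_le_left _ _)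

lemma aux_cut_zero (ε : ℝ) (hε : 0 < ε) (ξ : ℝ) (h : ε ≤ |ξ|) : cut ε ξ = 0 := by
  unfold cut; rw [if_neg (by linarith), if_pos h]

lemma aux_cutd_abs (ε : ℝ) (hε : 0 < ε) (ξ : ℝ) : |auxCutd ε ξ| ≤ 2 / ε := by
  unfold auxCutd
  have : 0 < 2 / ε := by positivity
  split_ifs
  · simpa using this.le
  · rw [neg_div, abs_neg, abs_of_pos this]
  · rw [abs_of_pos this]

lemma aux_cutd_measurable (ε : ℝ) : Measurable (auxCutd ε) := by
  unfold auxCutd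
  refine Measurable.ite (measurableSet_le (by fun_prop) (by fun_prop)) (by fun_prop) ?_
  exact Measurable.ite (measurableSet_le (by fun_prop) (by fun_prop)) (by fun_prop) (by fun_prop)

lemma aux_cut_deriv (ε : ℝ) (hε : 0 < ε) (ξ : ℝ) (h : |ξ| < ε) (h2 : |ξ| ≠ ε / 2) :
    HasDerivAt (cut ε) (auxCutd ε ξ) ξ := by
  have hca : ContinuousAt (fun t : ℝ => |t|) ξ := continuous_abs.continuousAt
  rcases lt_or_gt_of_ne h2 with h3 | h3
  · have e : cut ε =ᶠ[𝓝 ξ] fun _ => 1 := by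
      filter_upwards [hca.eventually_lt_const h3] with t ht
      unfold cut; rw [if_pos ht.le]
    have : auxCutd ε ξ = 0 := by unfold auxCutd; rw [if_pos h3.le]
    rw [this]
    exact (hasDerivAt_const ξ (1 : ℝ)).congr_of_eventuallyEq e
  · have e : cut ε =ᶠ[𝓝 ξ] fun t => 2 * (ε - |t|) / ε := by
      filter_upwards [hca.eventually_lt_const h, hca.eventually_const_lt h3] with t ht ht'
      unfold cut; rw [if_neg (by linarith), if_neg (by linarith)]
    have hne : ξ ≠ 0 := by
      rintro rfl; rw [abs_zero] at h3; linarith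
    rcases lt_or_gt_of_ne hne with h0 | h0
    · have e2 : cut ε =ᶠ[𝓝 ξ] fun t => 2 * (ε + t) / ε := by
        filter_upwards [e, eventually_lt_nhds h0] with t ht ht'
        rw [ht, abs_of_neg ht', sub_neg_eq_add]
      have : auxCutd ε ξ = 2 * 1 / ε := by
        unfold auxCutd; rw [if_neg (by linarith), if_neg (by linarith), mul_one]
      rw [this]
      exact ((((hasDerivAt_id ξ).const_add ε).const_mul 2).div_const ε).congr_of_eventuallyEq e2
    · have e2 : cut ε =ᶠ[𝓝 ξ] fun t => 2 * (ε - t) / ε := by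
        filter_upwards [e, eventually_gt_nhds h0] with t ht ht'
        rw [ht, abs_of_pos ht']
      have : auxCutd ε ξ = 2 * (-1) / ε := by
        unfold auxCutd; rw [if_neg (by linarith), if_pos h0.le]; norm_num
      rw [this]
      exact ((((hasDerivAt_id ξ).const_sub ε).const_mul 2).div_const ε).congr_of_eventuallyEq e2

lemma aux_integral_indicator {E : Type*} [NormedAddCommGroup E] [NormedSpace ℝ E]
    (ε : ℝ) (hε0 : 0 < ε) (hεπ : ε ≤ π) (F : ℝ → E) :
    ∫ x in (-π)..π, (Set.Ioc (-ε) ε).indicator F x = ∫ x in (-ε)..ε, F x := by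
  rw [intervalIntegral.integral_of_le (by linarith), intervalIntegral.integral_of_le (by linarith),
    setIntegral_indicator measurableSet_Ioc,
    Set.inter_eq_right.2 (Set.Ioc_subset_Ioc (by linarith) hεπ)]

lemma aux_memLp (ε C : ℝ) (F : ℝ → ℂ)
    (hm : AEStronglyMeasurable F (volume.restrict (Set.Ioc (-ε) ε)))
    (hC : ∀ x ∈ Set.Ioc (-ε) ε, ‖F x‖ ≤ C) :
    MemLp ((Set.Ioc (-ε) ε).indicator F) 2 (volume.restrict (Set.Ioc (-π) π)) := by
  have h1 : MemLp F 2 (volume.restrict (Set.Ioc (-ε) ε)) := by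
    refine MemLp.of_bound hm C ?_
    exact (ae_restrict_iff' measurableSet_Ioc).2 (Eventually.of_forall hC)
  exact ((memLp_indicator_iff_restrict measurableSet_Ioc).2 h1).restrict _

lemma aux_cut_norm (ε x : ℝ) (h h' : ℝ → ℂ) (hε0 : 0 < ε) (hεπ : ε ≤ π)
    (hd : ∀ ξ ∈ Set.Icc (-ε) ε, HasDerivWithinAt h (h' ξ) (Set.Icc (-ε) ε) ξ)
    (hc' : ContinuousOn h' (Set.Icc (-ε) ε)) :
    wienerNorm (fun ξ => (cut ε ξ : ℂ) * h ξ) ≤ Real.sqrt (π / 9 *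
      (4 * (∫ ξ in (-ε)..ε, ‖h ξ‖ ^ 2) +
        ∫ ξ in (-ε)..ε, (2 / ε * ‖h ξ‖ + ‖h' ξ - Complex.I * x * h ξ‖) ^ 2)) := by
  have hc : ContinuousOn h (Set.Icc (-ε) ε) := fun ξ hξ => (hd ξ hξ).continuousWithinAt
  set p : ℝ → ℂ := fun ξ => h' ξ - Complex.I * x * h ξ with hp
  have hpc : ContinuousOn p (Set.Icc (-ε) ε) := hc'.sub (continuousOn_const.mul hc)
  have hcut := aux_cut_continuous ε hε0
  have hcutC : Continuous (fun ξ => (cut ε ξ : ℂ)) := Complex.continuous_ofReal.comp hcut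
  set F : ℝ → ℂ := fun ξ => (cut ε ξ : ℂ) * h ξ with hF
  set F2 : ℝ → ℂ := fun ξ => (auxCutd ε ξ : ℂ) * h ξ + (cut ε ξ : ℂ) * p ξ with hF2
  have hFc : ContinuousOn F (Set.Icc (-ε) ε) := hcutC.continuousOn.mul hc
  have hsub : Set.Ioc (-ε) ε ⊆ Set.Icc (-ε) ε := Set.Ioc_subset_Icc_self
  have hnF : ∀ ξ, ‖F ξ‖ ≤ ‖h ξ‖ := fun ξ => by
    rw [hF]; simp only [norm_mul, Complex.norm_real, Real.norm_eq_abs]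
    rw [abs_of_nonneg (aux_cut_nonneg ε hε0 ξ)]
    exact mul_le_of_le_one_left (norm_nonneg _) (aux_cut_le_one ε hε0 ξ)
  have hnF2 : ∀ ξ, ‖F2 ξ‖ ≤ 2 / ε * ‖h ξ‖ + ‖p ξ‖ := fun ξ => by
    refine (norm_add_le _ _).trans (add_le_add ?_ ?_)
    · rw [norm_mul, Complex.norm_real, Real.norm_eq_abs]
      exact mul_le_mul_of_nonneg_right (aux_cutd_abs ε hε0 ξ) (norm_nonneg _)
    · rw [norm_mul, Complex.norm_real, Real.norm_eq_abs, abs_of_nonneg (aux_cut_nonneg ε hε0 ξ)]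
      exact mul_le_of_le_one_left (norm_nonneg _) (aux_cut_le_one ε hε0 ξ)
  obtain ⟨Ch, hCh⟩ := isCompact_Icc.exists_bound_of_continuousOn hc
  obtain ⟨Cp, hCp⟩ := isCompact_Icc.exists_bound_of_continuousOn hpc
  have hFm : AEStronglyMeasurable F (volume.restrict (Set.Ioc (-ε) ε)) :=
    (hFc.mono hsub).aestronglyMeasurable measurableSet_Ioc
  have hF2m : AEStronglyMeasurable F2 (volume.restrict (Set.Ioc (-ε) ε)) := by
    refine AEStronglyMeasurable.add (AEStronglyMeasurable.mul ?_ ?_) ?_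
    · exact (Complex.measurable_ofReal.comp (aux_cutd_measurable ε)).aestronglyMeasurable
    · exact (hc.mono hsub).aestronglyMeasurable measurableSet_Ioc
    · exact ((hcutC.continuousOn.mul hpc).mono hsub).aestronglyMeasurable measurableSet_Ioc
  have hF2b : ∀ ξ ∈ Set.Icc (-ε) ε, ‖F2 ξ‖ ≤ 2 / ε * Ch + Cp := fun ξ hξ =>
    (hnF2 ξ).trans (add_le_add (mul_le_mul_of_nonneg_left (hCh ξ hξ) (by positivity)) (hCp ξ hξ))
  have hM := aux_memLp ε Ch F hFm fun ξ hξ => (hnF ξ).trans (hCh ξ (hsub hξ))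
  have hM2 := aux_memLp ε _ F2 hF2m fun ξ hξ => hF2b ξ (hsub hξ)
  have hFi : (Set.Ioc (-ε) ε).indicator F = F := by
    rw [Set.indicator_eq_self]
    intro ξ hξ
    by_contra hn
    apply hξ
    have : ε ≤ |ξ| := by
      by_contra hlt
      push Not at hlt
      exact hn ⟨(abs_lt.1 hlt).1, (abs_lt.1 hlt).2.le⟩
    simp [hF, aux_cut_zero ε hε0 ξ this]
  have hco : ∀ (G : ℝ → ℂ) (n : ℤ), fCoeff ((Set.Ioc (-ε) ε).indicator G) n =
      (∫ θ in (-ε)..ε, G θ * Complex.exp (-(Complex.I * (n : ℂ) * (θ : ℂ)))) /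
        ((2 * π : ℝ) : ℂ) := by
    intro G n
    unfold fCoeff
    rw [← aux_integral_indicator ε hε0 hεπ]
    congr 2
    ext θ
    by_cases hθ : θ ∈ Set.Ioc (-ε) ε <;> simp [hθ]
  have hF2i : IntervalIntegrable F2 volume (-ε) ε := by
    rw [intervalIntegrable_iff_integrableOn_Ioc_of_le (by linarith)]
    exact Integrable.of_bound hF2m (2 / ε * Ch + Cp)
      ((ae_restrict_iff' measurableSet_Ioc).2 (Eventually.of_forall fun ξ hξ => hF2b ξ (hsub hξ)))
  have hIcc : Set.uIcc (-ε) ε = Set.Icc (-ε) ε := Set.uIcc_of_le (by linarith)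
  have hrel : ∀ n : ℤ, fCoeff ((Set.Ioc (-ε) ε).indicator F2) n =
      Complex.I * ((n : ℂ) - x) * fCoeff ((Set.Ioc (-ε) ε).indicator F) n := by
    intro n
    rw [hco, hco]
    set e : ℝ → ℂ := fun θ => Complex.exp (-(Complex.I * (n : ℂ) * (θ : ℂ))) with he
    have hec : Continuous e := by rw [he]; fun_prop
    have hi1 : IntervalIntegrable (fun θ => F2 θ * e θ) volume (-ε) ε :=
      hF2i.mul_continuousOn hec.continuousOn
    have hi2 : IntervalIntegrable (fun θ => Complex.I * ((n : ℂ) - x) * (F θ * e θ))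
        volume (-ε) ε := by
      apply ContinuousOn.intervalIntegrable
      rw [hIcc]
      exact continuousOn_const.mul (hFc.mul hec.continuousOn)
    have hz := integral_eq_of_hasDerivAt_off_countable_of_le (fun θ => F θ * e θ)
      (fun θ => F2 θ * e θ - Complex.I * ((n : ℂ) - x) * (F θ * e θ)) (a := -ε) (b := ε)
      (by linarith) (s := {-(ε / 2), ε / 2}) (Set.Countable.insert _ (Set.countable_singleton _))
      (hFc.mul hec.continuousOn) ?_ (hi1.sub hi2)
    · have hz0 : F ε = 0 ∧ F (-ε) = 0 := by
        constructor
        · simp [hF, aux_cut_zero ε hε0 ε (le_abs_self _)]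
        · simp [hF, aux_cut_zero ε hε0 (-ε) (by rw [abs_neg]; exact le_abs_self _)]
      rw [intervalIntegral.integral_sub hi1 hi2, intervalIntegral.integral_const_mul,
        hz0.1, hz0.2, zero_mul, zero_mul, sub_zero, sub_eq_zero] at hz
      rw [hz, mul_div_assoc]
    · intro θ hθ
      have hab : |θ| < ε := abs_lt.2 hθ.1
      have hab2 : |θ| ≠ ε / 2 := by
        intro hh
        apply hθ.2
        rcases abs_choice θ with h1 | h1
        · right; simp only [Set.mem_singleton_iff]; linarith
        · left; linarith
      have d1 := (aux_cut_deriv ε hε0 θ hab hab2).ofReal_comp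
      have d2 := (hd θ ⟨hθ.1.1.le, hθ.1.2.le⟩).hasDerivAt (Icc_mem_nhds hθ.1.1 hθ.1.2)
      have d3 : HasDerivAt e (-(Complex.I * n) * e θ) θ := by
        have : HasDerivAt (fun θ : ℝ => -(Complex.I * (n : ℂ) * (θ : ℂ))) (-(Complex.I * n * 1)) θ :=
          ((hasDerivAt_id θ).ofReal_comp.const_mul _).neg
        have := this.cexp
        rw [mul_one] at this
        rw [mul_comm]
        exact this
      have := (d1.mul d2).mul d3
      refine this.congr_deriv ?_
      simp only [hF2, hF, hp, Pi.mul_apply]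
      ring
  have hfin := aux_cs _ _ x hM hM2 (fun n => by
    rw [hrel n, norm_mul, norm_mul, Complex.norm_I, one_mul]
    congr 1
    rw [← Real.norm_eq_abs, ← Complex.norm_real]
    push_cast; rfl)
  rw [hFi] at hfin
  refine hfin.trans (Real.sqrt_le_sqrt ?_)
  have hsq : ∀ G : ℝ → ℂ, ∫ ξ in (-π)..π, ‖(Set.Ioc (-ε) ε).indicator G ξ‖ ^ 2 =
      ∫ ξ in (-ε)..ε, ‖G ξ‖ ^ 2 := by
    intro G
    rw [← aux_integral_indicator ε hε0 hεπ]
    congr 1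
    ext θ
    by_cases hθ : θ ∈ Set.Ioc (-ε) ε <;> simp [hθ]
  have hsqF := hsq F
  rw [hFi] at hsqF
  rw [hsqF, hsq F2]
  have i1 : ∫ ξ in (-ε)..ε, ‖F ξ‖ ^ 2 ≤ ∫ ξ in (-ε)..ε, ‖h ξ‖ ^ 2 := by
    apply intervalIntegral.integral_mono_on (by linarith)
    · exact ContinuousOn.intervalIntegrable (by rw [hIcc]; exact hFc.norm.pow 2)
    · exact ContinuousOn.intervalIntegrable (by rw [hIcc]; exact hc.norm.pow 2)
    · intro ξ _
      exact pow_le_pow_left₀ (norm_nonneg _) (hnF ξ) 2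
  have i2 : ∫ ξ in (-ε)..ε, ‖F2 ξ‖ ^ 2 ≤ ∫ ξ in (-ε)..ε, (2 / ε * ‖h ξ‖ + ‖p ξ‖) ^ 2 := by
    apply intervalIntegral.integral_mono_on (by linarith)
    · rw [intervalIntegrable_iff_integrableOn_Ioc_of_le (by linarith)]
      refine Integrable.of_bound (hF2m.norm.pow 2) ((2 / ε * Ch + Cp) ^ 2)
        ((ae_restrict_iff' measurableSet_Ioc).2 (Eventually.of_forall fun ξ hξ => ?_))
      rw [Real.norm_eq_abs, abs_of_nonneg (by positivity)]
      exact pow_le_pow_left₀ (norm_nonneg _) (hF2b ξ (hsub hξ)) 2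
    · exact ContinuousOn.intervalIntegrable (by
        rw [hIcc]; exact ((continuousOn_const.mul hc.norm).add hpc.norm).pow 2)
    · intro ξ _
      exact pow_le_pow_left₀ (norm_nonneg _) (hnF2 ξ) 2
  have := Real.pi_pos
  gcongr

set_option maxHeartbeats 2000000 in
lemma aux_final (r : ℕ) (ε K B : ℝ) (U V : ℝ → ℝ) (hε : 0 < ε) (hK : 1 ≤ K)
    (hUc : ContinuousOn U (Set.Icc (-ε) ε)) (hVc : ContinuousOn V (Set.Icc (-ε) ε))
    (hU0 : ∀ x, 0 ≤ U x) (hV0 : ∀ x, 0 ≤ V x)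
    (hU : ∀ x ∈ Set.Icc (-ε) ε, U x ≤ B * |x| ^ (r + 1) * Real.exp (-K * x ^ 2 / 2))
    (hV : ∀ x ∈ Set.Icc (-ε) ε, V x ≤
      B * |x| ^ r * ((r + 1) + 3 * K * x ^ 2) * Real.exp (-K * x ^ 2 / 2)) :
    4 * (∫ x in (-ε)..ε, U x ^ 2) + ∫ x in (-ε)..ε, (2 / ε * U x + V x) ^ 2 ≤
      6 * (ε⁻¹ + Real.sqrt (5 * (r + 1))) ^ 2 *
        (B ^ 2 * (Real.Gamma (r + 3 / 2) * K ^ (-((r : ℝ) + 1 / 2)))) := by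
  have hK0 : 0 < K := by linarith
  have hIcc : Set.uIcc (-ε) ε = Set.Icc (-ε) ε := Set.uIcc_of_le (by linarith)
  set Y := Real.sqrt (5 * ((r : ℝ) + 1)) with hY
  have hr0 : (0 : ℝ) ≤ r := Nat.cast_nonneg r
  have hY2 : Y ^ 2 = 5 * ((r : ℝ) + 1) := Real.sq_sqrt (by positivity)
  have hYpos : 0 < Y := Real.sqrt_pos.2 (by positivity)
  set z := ε⁻¹ with hz
  have hzpos : 0 < z := inv_pos.2 hε
  have hzε : 2 / ε = 2 * z := by rw [hz]; ring
  set T := Real.Gamma (r + 3 / 2) * K ^ (-((r : ℝ) + 1 / 2)) with hT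
  have hT0 : 0 ≤ T := mul_nonneg (Real.Gamma_nonneg_of_nonneg (by positivity)) (by positivity)
  set M : ℕ → ℝ := fun j => ∫ x in (-ε)..ε, x ^ (2 * j) * Real.exp (-K * x ^ 2) with hM
  have hMi : ∀ j : ℕ, IntervalIntegrable (fun x : ℝ => x ^ (2 * j) * Real.exp (-K * x ^ 2))
      volume (-ε) ε := fun j => (aux_moment_integrable K hK0 j).intervalIntegrable
  have hG1 : Real.Gamma ((r : ℝ) + 3 / 2) = (r + 1 / 2) * Real.Gamma (r + 1 / 2) := by
    rw [← Real.Gamma_add_one (by positivity)]; congr 1; ring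
  have hG2 : Real.Gamma ((r : ℝ) + 5 / 2) = (r + 3 / 2) * Real.Gamma (r + 3 / 2) := by
    rw [← Real.Gamma_add_one (by positivity)]; congr 1; ring
  have m0 : (r + 1 / 2) * M r ≤ T := by
    have := aux_moment ε K hε hK0 r
    rw [hT, hG1, mul_assoc]
    exact mul_le_mul_of_nonneg_left this (by positivity)
  have m1 : K * M (r + 1) ≤ T := by
    have := aux_moment ε K hε hK0 (r + 1)
    have e1 : (((r + 1 : ℕ) : ℝ) + 1 / 2) = r + 3 / 2 := by push_cast; ring
    rw [e1] at this
    have e2 : K ^ (-((r : ℝ) + 1 / 2)) = K * K ^ (-((r : ℝ) + 3 / 2)) := by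
      rw [← Real.rpow_one_add' hK0.le (by linarith)]; congr 1; ring
    rw [hT, e2]
    calc K * M (r + 1) ≤ K * (Real.Gamma (r + 3 / 2) * K ^ (-((r : ℝ) + 3 / 2))) :=
          mul_le_mul_of_nonneg_left this hK0.le
      _ = _ := by ring
  have m2 : K ^ 2 * M (r + 2) ≤ (r + 3 / 2) * T := by
    have := aux_moment ε K hε hK0 (r + 2)
    have e1 : (((r + 2 : ℕ) : ℝ) + 1 / 2) = r + 5 / 2 := by push_cast; ring
    rw [e1] at this
    have e2 : K ^ (-((r : ℝ) + 1 / 2)) = K ^ 2 * K ^ (-((r : ℝ) + 5 / 2)) := by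
      rw [← Real.rpow_natCast, ← Real.rpow_add hK0]; congr 1; push_cast; ring
    rw [hT, e2]
    calc K ^ 2 * M (r + 2) ≤ K ^ 2 * (Real.Gamma (r + 5 / 2) * K ^ (-((r : ℝ) + 5 / 2))) :=
          mul_le_mul_of_nonneg_left this (by positivity)
      _ = _ := by rw [hG2]; ring
  have hM0 : ∀ j, 0 ≤ M j := fun j => by
    apply intervalIntegral.integral_nonneg (by linarith)
    intro x _
    have : 0 ≤ x ^ (2 * j) := by rw [pow_mul]; positivity
    positivity
  have hexp : ∀ x : ℝ, Real.exp (-K * x ^ 2 / 2) ^ 2 = Real.exp (-K * x ^ 2) := fun x => by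
    rw [← Real.exp_nat_mul]; congr 1; push_cast; ring
  have hab : ∀ (x : ℝ) (j : ℕ), (|x| ^ j) ^ 2 = x ^ (2 * j) := fun x j => by
    rw [← pow_mul, mul_comm, pow_mul, sq_abs, ← pow_mul]
  -- first integral
  have i1 : ∫ x in (-ε)..ε, U x ^ 2 ≤ B ^ 2 * M (r + 1) := by
    rw [hM, ← intervalIntegral.integral_const_mul]
    apply intervalIntegral.integral_mono_on (by linarith)
    · exact ContinuousOn.intervalIntegrable (by rw [hIcc]; exact hUc.pow 2)
    · exact (hMi _).const_mul _
    · intro x hx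
      refine (pow_le_pow_left₀ (hU0 x) (hU x hx) 2).trans_eq ?_
      rw [mul_pow, mul_pow, hab, hexp]; ring
  set a1 := (1 + Y / z) * (4 * z ^ 2) with ha1
  set a2 := 1 + z / Y with ha2
  have i2 : ∫ x in (-ε)..ε, (2 / ε * U x + V x) ^ 2 ≤
      B ^ 2 * (a1 * M (r + 1) + a2 * (((r : ℝ) + 1) ^ 2 * M r + 6 * (r + 1) * K * M (r + 1)
        + 9 * K ^ 2 * M (r + 2))) := by
    have : B ^ 2 * (a1 * M (r + 1) + a2 * (((r : ℝ) + 1) ^ 2 * M r + 6 * (r + 1) * K * M (r + 1)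
        + 9 * K ^ 2 * M (r + 2))) = B ^ 2 * (a2 * ((r : ℝ) + 1) ^ 2) * M r +
        B ^ 2 * (a1 + a2 * (6 * (r + 1) * K)) * M (r + 1) +
        B ^ 2 * (a2 * (9 * K ^ 2)) * M (r + 2) := by ring
    rw [this, hM]
    simp only []
    rw [← intervalIntegral.integral_const_mul, ← intervalIntegral.integral_const_mul,
      ← intervalIntegral.integral_const_mul, ← intervalIntegral.integral_add
        ((hMi _).const_mul _) ((hMi _).const_mul _), ← intervalIntegral.integral_add
        (((hMi _).const_mul _).add ((hMi _).const_mul _)) ((hMi _).const_mul _)]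
    apply intervalIntegral.integral_mono_on (by linarith)
    · exact ContinuousOn.intervalIntegrable (by
        rw [hIcc]; exact ((continuousOn_const.mul hUc).add hVc).pow 2)
    · exact (((hMi _).const_mul _).add ((hMi _).const_mul _)).add ((hMi _).const_mul _)
    · intro x hx
      have hx1 : 2 / ε * U x + V x ≤ B * |x| ^ r * Real.exp (-K * x ^ 2 / 2) *
          (2 * z * |x| + ((r + 1) + 3 * K * x ^ 2)) := by
        rw [hzε]
        have h1 := mul_le_mul_of_nonneg_left (hU x hx) (by positivity : 0 ≤ 2 * z)
        have h2 := hV x hx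
        calc _ ≤ _ := add_le_add h1 h2
          _ = _ := by rw [pow_succ]; ring
      have hx0 : 0 ≤ 2 / ε * U x + V x :=
        add_nonneg (mul_nonneg (by positivity) (hU0 x)) (hV0 x)
      refine (pow_le_pow_left₀ hx0 hx1 2).trans ?_
      rw [mul_pow, mul_pow, mul_pow, hab, hexp]
      set q : ℝ := (r + 1) + 3 * K * x ^ 2 with hq
      have hq2 : (2 * z * |x| + q) ^ 2 ≤ a1 * x ^ 2 + a2 * q ^ 2 := by
        have hs : |x| ^ 2 = x ^ 2 := sq_abs x
        have e : a1 * x ^ 2 + a2 * q ^ 2 - (2 * z * |x| + q) ^ 2 =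
            (2 * Y * |x| - q) ^ 2 * (z / Y) := by
          rw [ha1, ha2, ← hs]; field_simp; ring
        have : 0 ≤ (2 * Y * |x| - q) ^ 2 * (z / Y) := by positivity
        linarith
      have hpos : 0 ≤ B ^ 2 * x ^ (2 * r) * Real.exp (-K * x ^ 2) := by
        have : 0 ≤ x ^ (2 * r) := by rw [pow_mul]; positivity
        positivity
      refine (mul_le_mul_of_nonneg_left hq2 hpos).trans_eq ?_
      rw [hq]
      have p1 : x ^ (2 * (r + 1)) = x ^ (2 * r) * x ^ 2 := by rw [← pow_add]; rfl
      have p2 : x ^ (2 * (r + 2)) = x ^ (2 * r) * x ^ 4 := by rw [← pow_add]; rfl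
      rw [p1, p2]; ring
  have m1' : M (r + 1) ≤ T := by nlinarith [hM0 (r + 1)]
  have m0' : ((r : ℝ) + 1) ^ 2 * M r ≤ (r + 2) * T := by
    have h1 : ((r : ℝ) + 1) ^ 2 * M r ≤ ((r + 2) * (r + 1 / 2)) * M r :=
      mul_le_mul_of_nonneg_right (by nlinarith) (hM0 r)
    have h2 := mul_le_mul_of_nonneg_left m0 (by positivity : (0 : ℝ) ≤ r + 2)
    linarith
  have hmid : ((r : ℝ) + 1) ^ 2 * M r + 6 * (r + 1) * K * M (r + 1) + 9 * K ^ 2 * M (r + 2) ≤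
      (43 / 10 * Y ^ 2) * T := by
    have h1 := mul_le_mul_of_nonneg_left m1 (by positivity : (0 : ℝ) ≤ 6 * (r + 1))
    rw [hY2]
    have : 0 ≤ (r : ℝ) * T := by positivity
    nlinarith
  have ha2p : 0 ≤ a2 := by positivity
  have ha1p : 0 ≤ a1 := by positivity
  have hB : 0 ≤ B ^ 2 := by positivity
  calc _ ≤ 4 * (B ^ 2 * T) + B ^ 2 * (a1 * T + a2 * ((43 / 10 * Y ^ 2) * T)) := by
        refine add_le_add (mul_le_mul_of_nonneg_left (i1.trans ?_) (by norm_num)) (i2.trans ?_)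
        · gcongr
        · gcongr
    _ = (4 + a1 + a2 * (43 / 10 * Y ^ 2)) * (B ^ 2 * T) := by ring
    _ ≤ _ := by
        apply mul_le_mul_of_nonneg_right _ (by positivity)
        have e1 : a1 = 4 * z ^ 2 + 4 * Y * z := by rw [ha1]; field_simp
        have e2 : a2 * (43 / 10 * Y ^ 2) = 43 / 10 * Y ^ 2 + 43 / 10 * Y * z := by
          rw [ha2]; field_simp
        rw [e1, e2]
        have : 0 < Y * z := by positivity
        nlinarith

lemma aux_taylor (ε β : ℝ) (hε : 0 < ε) (r : ℕ) (g : ℝ → ℂ)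
    (hg : ContDiffOn ℝ ((r + 1 : ℕ) : ℕ∞) g (Set.Icc (-ε) ε))
    (hv : ∀ s : ℕ, s ≤ r → iteratedDerivWithin s g (Set.Icc (-ε) ε) 0 = 0)
    (hb : ∀ x ∈ Set.Icc (-ε) ε, ‖iteratedDerivWithin (r + 1) g (Set.Icc (-ε) ε) x‖ ≤ β) :
    ∀ j : ℕ, j ≤ r + 1 → ∀ x ∈ Set.Icc (-ε) ε,
      ‖iteratedDerivWithin (r + 1 - j) g (Set.Icc (-ε) ε) x‖ ≤ β / (Nat.factorial j) * |x| ^ j := by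
  have hud : UniqueDiffOn ℝ (Set.Icc (-ε) ε) := uniqueDiffOn_Icc (by linarith)
  intro j
  induction j with
  | zero => intro _ x hx; simpa using hb x hx
  | succ j ih =>
    intro hj x hx
    have ih := ih (by omega)
    have hs : r + 1 - j = (r + 1 - (j + 1)) + 1 := by omega
    have := aux_growth ε (β / (Nat.factorial j)) j
      (iteratedDerivWithin (r + 1 - (j + 1)) g (Set.Icc (-ε) ε))
      (iteratedDerivWithin (r + 1 - j) g (Set.Icc (-ε) ε)) ?_ (hv _ (by omega)) ih x hx
    · refine this.trans_eq ?_
      rw [Nat.factorial_succ]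
      push_cast
      field_simp
    · intro y hy
      have hd := hg.differentiableOn_iteratedDerivWithin (m := r + 1 - (j + 1))
        (WithTop.coe_lt_coe.2 (by exact_mod_cast (by omega : r + 1 - (j + 1) < r + 1))) hud
      rw [hs, iteratedDerivWithin_succ]
      exact (hd y hy).hasDerivWithinAt

lemma aux_phi (L : LevyExponent) (ε : ℝ)
    (hγ : gammaB L.φ L.σ2 ε ≤ L.σ2 / 2) :
    (∀ x ∈ Set.Icc (-ε) ε, (L.φ x).re ≤ -(L.σ2 / 4) * x ^ 2) ∧
    (∀ x ∈ Set.Icc (-ε) ε, ‖deriv L.φ x - Complex.I * L.m‖ ≤ 3 / 2 * L.σ2 * |x|) := by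
  have hσ := L.σ2_pos
  have hφ0 : L.φ 0 = 0 := by
    have h := L.taylor.bound (c := 1) one_pos
    have := h.self_of_nhds
    simpa using this
  have hdiff : Differentiable ℝ L.φ := L.smooth.differentiable (by norm_num)
  have hd1 : ContDiff ℝ 1 (deriv L.φ) := ((contDiff_succ_iff_deriv (n := 1)).1 L.smooth).2.2
  have hdiff2 : Differentiable ℝ (deriv L.φ) := hd1.differentiable (by norm_num)
  have hi2 : iteratedDeriv 2 L.φ = deriv (deriv L.φ) := by
    rw [iteratedDeriv_succ, iteratedDeriv_one]
  have hc2 : Continuous (deriv (deriv L.φ)) := hd1.continuous_deriv (by norm_num)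
  set R : ℝ → ℂ := fun ξ => L.φ ξ - (Complex.I * (L.m : ℂ) * (ξ : ℂ) -
    (L.σ2 : ℂ) * (ξ : ℂ) ^ 2 / 2) with hR
  set R' : ℝ → ℂ := fun ξ => deriv L.φ ξ - (Complex.I * (L.m : ℂ) - (L.σ2 : ℂ) * (ξ : ℂ)) with hR'
  have hR0 : R 0 = 0 := by simp [hR, hφ0]
  have hRd : ∀ x, HasDerivAt R (R' x) x := by
    intro x
    have h1 := (hdiff x).hasDerivAt
    have hid := (hasDerivAt_id x).ofReal_comp
    have h2 := hid.const_mul (Complex.I * (L.m : ℂ))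
    have h3 := ((hid.pow 2).const_mul (L.σ2 : ℂ)).div_const 2
    refine (h1.sub (h2.sub h3)).congr_deriv ?_
    simp [hR']
    ring
  have hR'd : ∀ x, HasDerivAt R' (deriv (deriv L.φ) x + L.σ2) x := by
    intro x
    have h1 := (hdiff2 x).hasDerivAt
    have hid := (hasDerivAt_id x).ofReal_comp
    have h2 := (hid.const_mul (L.σ2 : ℂ)).const_sub (Complex.I * (L.m : ℂ))
    refine (h1.sub h2).congr_deriv ?_
    simp
  have hR'0 : R' 0 = 0 := by
    have h0 : HasDerivAt R 0 0 := by
      rw [hasDerivAt_iff_isLittleO]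
      simp only [hR0, sub_zero, smul_zero]
      refine L.taylor.trans_isBigO ?_
      have : (fun x : ℝ => x ^ 2) =o[𝓝 0] fun x : ℝ => x ^ 1 := isLittleO_pow_pow one_lt_two
      simpa using this.isBigO
    exact (hRd 0).unique h0
  have hbd : ∀ x ∈ Set.Icc (-ε) ε, ‖deriv (deriv L.φ) x + L.σ2‖ ≤ L.σ2 / 2 * |x| ^ 0 := by
    intro x hx
    rw [pow_zero, mul_one]
    refine le_trans ?_ hγ
    apply le_csSup
    · rw [hi2]
      exact (isCompact_Icc.image (by fun_prop)).bddAbove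
    · exact ⟨x, hx, by simp only [hi2]⟩
  have b1 := aux_growth ε (L.σ2 / 2) 0 R' _ (fun x _ => (hR'd x).hasDerivWithinAt) hR'0 hbd
  have b2 := aux_growth ε (L.σ2 / 2) 1 R R' (fun x _ => (hRd x).hasDerivWithinAt) hR0
    (fun x hx => by simpa using b1 x hx)
  constructor
  · intro x hx
    have h1 := b2 x hx
    have h2 := (Complex.re_le_norm (R x)).trans h1
    have h3 : (R x).re = (L.φ x).re + L.σ2 * x ^ 2 / 2 := by
      have : R x = L.φ x - (Complex.I * ((L.m * x : ℝ) : ℂ) - ((L.σ2 * x ^ 2 / 2 : ℝ) : ℂ)) := by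
        simp only [hR]; push_cast; ring
      rw [this, Complex.sub_re, Complex.sub_re, Complex.ofReal_re, Complex.re_mul_ofReal]
      simp
    rw [h3] at h2
    norm_num at h2
    linarith
  · intro x hx
    have h1 := b1 x hx
    have h2 : deriv L.φ x - Complex.I * L.m = R' x - ((L.σ2 * x : ℝ) : ℂ) := by
      simp only [hR']; push_cast; ring
    rw [h2]
    refine (norm_sub_le _ _).trans ?_
    rw [Complex.norm_real, Real.norm_eq_abs, abs_mul, abs_of_pos hσ]
    norm_num at h1
    linarith

/-- Lemma 2.5: in the one-dimensional concentration setting, with residues `ψ, χ` that are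
`(r+1)` times continuously differentiable on `[−ε,ε]` and whose Taylor expansions agree at `0`
up to order `r`, if `γ(ε) ≤ σ²/2` and `λ ≥ 2/σ²`, then
`‖c(ψ−χ)e^{λφ}‖_A ≤ C_{r+1}·β_{r+1}(ε)·(ε⁻¹+√(5(r+1)))/(σ²λ/2)^{r/2+1/4}`. -/
theorem norm_estimate_inside_cut (L : LevyExponent) (r : ℕ) (ε lam : ℝ) (ψ χ : ℝ → ℂ)
    (hε0 : 0 < ε) (hεπ : ε ≤ Real.pi)
    (hγ : gammaB L.φ L.σ2 ε ≤ L.σ2 / 2)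
    (hlam : 2 / L.σ2 ≤ lam)
    (hψA : MemWiener ψ) (hχA : MemWiener χ)
    (hψC : ContDiffOn ℝ ((r + 1 : ℕ) : ℕ∞) ψ (Set.Icc (-ε) ε))
    (hχC : ContDiffOn ℝ ((r + 1 : ℕ) : ℕ∞) χ (Set.Icc (-ε) ε))
    (hvanish : ∀ s : ℕ, s ≤ r →
      iteratedDerivWithin s (fun ξ => ψ ξ - χ ξ) (Set.Icc (-ε) ε) 0 = 0) :
    wienerNorm (fun ξ => (cut ε ξ : ℂ) * (ψ ξ - χ ξ) * Complex.exp ((lam : ℂ) * L.φ ξ)) ≤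
      Cconst (r + 1) * betaSup r ε ψ χ * (ε⁻¹ + Real.sqrt (5 * (r + 1))) /
        (L.σ2 * lam / 2) ^ ((r : ℝ) / 2 + 1 / 4) := by

  have hσ := L.σ2_pos
  obtain ⟨hre, hder⟩ := aux_phi L ε hγ
  set K : ℝ := L.σ2 * lam / 2 with hK
  have hK1 : 1 ≤ K := by
    rw [div_le_iff₀ hσ] at hlam
    rw [hK]; linarith
  have hK0 : 0 < K := by linarith
  have hlam0 : 0 < lam := lt_of_lt_of_le (by positivity) hlam
  set g : ℝ → ℂ := fun ξ => ψ ξ - χ ξ with hg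
  have hgC : ContDiffOn ℝ ((r + 1 : ℕ) : ℕ∞) g (Set.Icc (-ε) ε) := hψC.sub hχC
  have hud : UniqueDiffOn ℝ (Set.Icc (-ε) ε) := uniqueDiffOn_Icc (by linarith)
  set β := betaSup r ε ψ χ with hβ
  have hβb : ∀ x ∈ Set.Icc (-ε) ε,
      ‖iteratedDerivWithin (r + 1) g (Set.Icc (-ε) ε) x‖ ≤ β := by
    intro x hx
    apply le_csSup
    · exact (isCompact_Icc.image_of_continuousOn
        (hgC.continuousOn_iteratedDerivWithin le_rfl hud).norm).bddAbove
    · exact ⟨x, hx, rfl⟩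
  have hβ0 : 0 ≤ β := (norm_nonneg _).trans (hβb 0 ⟨by linarith, hε0.le⟩)
  have htay := aux_taylor ε β hε0 r g hgC hvanish hβb
  set B : ℝ := β / (Nat.factorial (r + 1)) with hB
  have hB0 : 0 ≤ B := by positivity
  set g' : ℝ → ℂ := derivWithin g (Set.Icc (-ε) ε) with hg'
  have hgb : ∀ x ∈ Set.Icc (-ε) ε, ‖g x‖ ≤ B * |x| ^ (r + 1) := by
    intro x hx
    simpa using htay (r + 1) le_rfl x hx
  have hg'b : ∀ x ∈ Set.Icc (-ε) ε, ‖g' x‖ ≤ B * (r + 1) * |x| ^ r := by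
    intro x hx
    have := htay r (by omega) x hx
    rw [Nat.add_sub_cancel_left, iteratedDerivWithin_one] at this
    refine this.trans_eq ?_
    rw [hB, Nat.factorial_succ]
    push_cast
    field_simp
  have hgd : ∀ x ∈ Set.Icc (-ε) ε, HasDerivWithinAt g (g' x) (Set.Icc (-ε) ε) x := fun x hx =>
    (hgC.differentiableOn (by simp) x hx).hasDerivWithinAt
  have hg'c : ContinuousOn g' (Set.Icc (-ε) ε) := by
    have := hgC.continuousOn_iteratedDerivWithin (m := 1) (by simp) hud
    rwa [iteratedDerivWithin_one] at this
  have hφd : Differentiable ℝ L.φ := L.smooth.differentiable (by norm_num)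
  have hφc : Continuous (deriv L.φ) := L.smooth.continuous_deriv (by norm_num)
  set e : ℝ → ℂ := fun ξ => Complex.exp ((lam : ℂ) * L.φ ξ) with he
  have hed : ∀ x, HasDerivAt e (lam * deriv L.φ x * e x) x := fun x => by
    have := ((hφd x).hasDerivAt.const_mul (lam : ℂ)).cexp
    rw [mul_comm]; exact this
  have hec : Continuous e := continuous_iff_continuousAt.2 fun x => (hed x).continuousAt
  have heb : ∀ x ∈ Set.Icc (-ε) ε, ‖e x‖ ≤ Real.exp (-K * x ^ 2 / 2) := by
    intro x hx
    rw [he]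
    simp only [Complex.norm_exp, Complex.re_ofReal_mul]
    apply Real.exp_le_exp.2
    have := mul_le_mul_of_nonneg_left (hre x hx) hlam0.le
    rw [hK]; linarith
  set h : ℝ → ℂ := fun ξ => g ξ * e ξ with hh
  set h' : ℝ → ℂ := fun ξ => g' ξ * e ξ + g ξ * (lam * deriv L.φ ξ * e ξ) with hh'
  have hgc : ContinuousOn g (Set.Icc (-ε) ε) := hgC.continuousOn
  have hhd : ∀ ξ ∈ Set.Icc (-ε) ε, HasDerivWithinAt h (h' ξ) (Set.Icc (-ε) ε) ξ := fun x hx =>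
    (hgd x hx).mul (hed x).hasDerivWithinAt
  have hhc : ContinuousOn h (Set.Icc (-ε) ε) := hgc.mul hec.continuousOn
  have hhc' : ContinuousOn h' (Set.Icc (-ε) ε) :=
    (hg'c.mul hec.continuousOn).add
      (hgc.mul (by fun_prop))
  have hmain := aux_cut_norm ε (lam * L.m) h h' hε0 hεπ hhd hhc'
  have hfun : (fun ξ => (cut ε ξ : ℂ) * (ψ ξ - χ ξ) * Complex.exp ((lam : ℂ) * L.φ ξ)) =
      fun ξ => (cut ε ξ : ℂ) * h ξ := by
    ext ξ; simp only [hh, hg, he]; ring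
  rw [hfun]
  refine hmain.trans ?_
  have hfin := aux_final r ε K B (fun ξ => ‖h ξ‖)
    (fun ξ => ‖h' ξ - Complex.I * ((lam * L.m : ℝ) : ℂ) * h ξ‖) hε0 hK1 hhc.norm
    (hhc'.sub (continuousOn_const.mul hhc)).norm (fun _ => norm_nonneg _) (fun _ => norm_nonneg _)
    (fun x hx => by
      simp only [hh, norm_mul]
      exact mul_le_mul (hgb x hx) (heb x hx) (norm_nonneg _) (by positivity))
    (fun x hx => by
      have e1 : h' x - Complex.I * ((lam * L.m : ℝ) : ℂ) * h x =
          (g' x + g x * (lam * (deriv L.φ x - Complex.I * L.m))) * e x := by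
        simp only [hh, hh']; push_cast; ring
      simp only [e1, norm_mul]
      refine mul_le_mul ?_ (heb x hx) (norm_nonneg _) (by positivity)
      refine (norm_add_le _ _).trans ?_
      have e2 : ‖g x * (lam * (deriv L.φ x - Complex.I * L.m))‖ ≤
          B * |x| ^ (r + 1) * (lam * (3 / 2 * L.σ2 * |x|)) := by
        rw [norm_mul, norm_mul, Complex.norm_real, Real.norm_eq_abs, abs_of_pos hlam0]
        exact mul_le_mul (hgb x hx) (mul_le_mul_of_nonneg_left (hder x hx) hlam0.le)
          (by positivity) (by positivity)
      refine (add_le_add (hg'b x hx) e2).trans_eq ?_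
      have hs : x ^ 2 = |x| ^ 2 := (sq_abs x).symm
      rw [hs, hK]
      ring)
  have hY : 0 ≤ ε⁻¹ + Real.sqrt (5 * (r + 1)) := by positivity
  have hC0 : 0 ≤ Cconst (r + 1) := by unfold Cconst; positivity
  apply Real.sqrt_le_iff.2
  refine ⟨by positivity, ?_⟩
  refine (mul_le_mul_of_nonneg_left hfin (by positivity : 0 ≤ π / 9)).trans_eq ?_
  have hGam : 0 ≤ Real.Gamma ((r : ℝ) + 3 / 2) := Real.Gamma_nonneg_of_nonneg (by positivity)
  have hCe : Cconst (r + 1) ^ 2 = (1 / (Nat.factorial (r + 1) : ℝ)) ^ 2 *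
      (2 * π / 3 * Real.Gamma ((r : ℝ) + 3 / 2)) := by
    unfold Cconst
    have e1 : (((r + 1 : ℕ) : ℝ) + 1 / 2) = r + 3 / 2 := by push_cast; ring
    rw [e1, mul_pow, Real.sq_sqrt (by positivity)]
  have hKe : (K ^ ((r : ℝ) / 2 + 1 / 4)) ^ 2 = K ^ ((r : ℝ) + 1 / 2) := by
    rw [← Real.rpow_mul_natCast hK0.le]; congr 1; push_cast; ring
  have hR : (Cconst (r + 1) * β * (ε⁻¹ + Real.sqrt (5 * (r + 1))) /
      K ^ ((r : ℝ) / 2 + 1 / 4)) ^ 2 = Cconst (r + 1) ^ 2 * β ^ 2 *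
      (ε⁻¹ + Real.sqrt (5 * (r + 1))) ^ 2 / (K ^ ((r : ℝ) / 2 + 1 / 4)) ^ 2 := by
    rw [div_pow, mul_pow, mul_pow]
  rw [hR, hCe, hKe, Real.rpow_neg hK0.le, hB]
  field_simp
  ring

end
end
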